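/- Let K be a field and (A,▷,◁,R,B) a finite-dimensional quadratic Rota–Baxter special apre-perm algebra of weight −1 over K. Define r ∈ A⊗A by r♯(a*) = R(B♮⁻¹(a*)) for all a* ∈ A*. Then: r + τ(r) = φ_B; consequently f(x)(r+τ(r)) = 0 and g(x)(r+τ(r)) = 0 for all x ∈ A and (r+τ(r))♯ = B♮⁻¹ is bijective; and SA(r) = 0. (Hence the associated special apre-perm bialgebra is factorizable.) -/

import Mathlib

open TensorProduct

noncomputable section

namespace Paper

variable {K : Type*} [Field K]

section Defs

variable {A : Type*} [AddCommGroup A] [Module K A]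
variable {V : Type*} [AddCommGroup V] [Module K V]

/-- Commutativity of a bilinear multiplication. -/
def IsComm (m : A →ₗ[K] A →ₗ[K] A) : Prop := ∀ x y, m x y = m y x

/-- Associativity of a bilinear multiplication. -/
def IsAssoc (m : A →ₗ[K] A →ₗ[K] A) : Prop := ∀ x y z, m (m x y) z = m x (m y z)

/-- `P` is an averaging operator on `(A, m)`. -/
def IsAveragingOp (m : A →ₗ[K] A →ₗ[K] A) (P : A →ₗ[K] A) : Prop :=
  ∀ x y, m (P x) (P y) = P (m (P x) y) ∧ P (m (P x) y) = P (m x (P y))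

/-- `(A, m, P, Q)` is an admissible averaging commutative algebra. -/
def IsAdmissibleAveraging (m : A →ₗ[K] A →ₗ[K] A) (P Q : A →ₗ[K] A) : Prop :=
  IsComm m ∧ IsAssoc m ∧ IsAveragingOp m P ∧
    ∀ x y, m (P x) (Q y) = Q (m (P x) y) ∧ Q (m (P x) y) = Q (m x (Q y))

/-- The flip `τ` on `A ⊗ A`. -/
def tau (r : A ⊗[K] A) : A ⊗[K] A := TensorProduct.comm K A A r

/-- The linear map `A* → A`, `a* ↦ r♯(a*)`, associated with `r ∈ A ⊗ A`,
determined by `⟨r♯(a*), b*⟩ = ⟨r, a* ⊗ b*⟩`. -/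
def sharp (r : A ⊗[K] A) : Module.Dual K A →ₗ[K] A :=
  (TensorProduct.lid K A).toLinearMap ∘ₗ LinearMap.applyₗ r ∘ₗ LinearMap.rTensorHom A

/-- `s ∈ A ⊗ A` is invariant on `(A, m)`:  `(id ⊗ L(x) - L(x) ⊗ id) s = 0` for all `x`. -/
def IsInvariant (m : A →ₗ[K] A →ₗ[K] A) (s : A ⊗[K] A) : Prop :=
  ∀ x : A, LinearMap.lTensor A (m x) s = LinearMap.rTensor A (m x) s

/-- `(u⊗v)⊗(u'⊗v') ↦ b(u⊗u') ⊗ v ⊗ v'`. -/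
def place1 (b : A ⊗[K] A →ₗ[K] A) :
    (A ⊗[K] A) ⊗[K] (A ⊗[K] A) →ₗ[K] A ⊗[K] (A ⊗[K] A) :=
  LinearMap.rTensor (A ⊗[K] A) b ∘ₗ (TensorProduct.tensorTensorTensorComm K A A A A).toLinearMap

/-- `(u⊗v)⊗(u'⊗v') ↦ u ⊗ b(v⊗u') ⊗ v'`. -/
def place2 (b : A ⊗[K] A →ₗ[K] A) :
    (A ⊗[K] A) ⊗[K] (A ⊗[K] A) →ₗ[K] A ⊗[K] (A ⊗[K] A) :=
  LinearMap.lTensor A (LinearMap.rTensor A b) ∘ₗ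
    LinearMap.lTensor A (TensorProduct.assoc K A A A).symm.toLinearMap ∘ₗ
      (TensorProduct.assoc K A A (A ⊗[K] A)).toLinearMap

/-- `(u⊗v)⊗(u'⊗v') ↦ u ⊗ u' ⊗ b(v⊗v')`. -/
def place3 (b : A ⊗[K] A →ₗ[K] A) :
    (A ⊗[K] A) ⊗[K] (A ⊗[K] A) →ₗ[K] A ⊗[K] (A ⊗[K] A) :=
  (TensorProduct.assoc K A A A).toLinearMap ∘ₗ LinearMap.lTensor (A ⊗[K] A) b ∘ₗ
    (TensorProduct.tensorTensorTensorComm K A A A A).toLinearMap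

/-- A bilinear multiplication as a linear map on the tensor square. -/
def liftM (m : A →ₗ[K] A →ₗ[K] A) : A ⊗[K] A →ₗ[K] A := TensorProduct.lift m

/-- The opposite multiplication as a linear map on the tensor square: `u ⊗ v ↦ m v u`. -/
def flipM (m : A →ₗ[K] A →ₗ[K] A) : A ⊗[K] A →ₗ[K] A :=
  TensorProduct.lift m ∘ₗ (TensorProduct.comm K A A).toLinearMap

/-- For `r = Σᵢ uᵢ ⊗ vᵢ`, the element
`𝐀(r) = Σᵢⱼ (uᵢ·uⱼ)⊗vᵢ⊗vⱼ − uᵢ⊗(uⱼ·vᵢ)⊗vⱼ + uᵢ⊗uⱼ⊗(vᵢ·vⱼ)` of `A⊗A⊗A`. -/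
def Acal (m : A →ₗ[K] A →ₗ[K] A) (r : A ⊗[K] A) : A ⊗[K] (A ⊗[K] A) :=
  place1 (liftM m) (r ⊗ₜ[K] r) - place2 (flipM m) (r ⊗ₜ[K] r) + place3 (liftM m) (r ⊗ₜ[K] r)

/-- `r` is a solution of the averaging associative Yang–Baxter equation (AAYBE) in
`(A, m, P, Q)`: `𝐀(r) = 0`, `(P⊗id − id⊗Q)(r) = 0` and `(Q⊗id − id⊗P)(r) = 0`. -/
def IsAAYBESolution (m : A →ₗ[K] A →ₗ[K] A) (P Q : A →ₗ[K] A) (r : A ⊗[K] A) : Prop :=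
  Acal m r = 0 ∧ LinearMap.rTensor A P r = LinearMap.lTensor A Q r ∧
    LinearMap.rTensor A Q r = LinearMap.lTensor A P r

/-- The co-multiplication `Δ_r : x ↦ (id ⊗ L(x) − L(x) ⊗ id)(r)`. -/
def DeltaMap (m : A →ₗ[K] A →ₗ[K] A) (r : A ⊗[K] A) : A →ₗ[K] A ⊗[K] A :=
  (LinearMap.applyₗ r ∘ₗ LinearMap.lTensorHom A) ∘ₗ m -
    (LinearMap.applyₗ r ∘ₗ LinearMap.rTensorHom A) ∘ₗ m

/-- The dual representation map `x ↦ (ρ(x))*`. -/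
def dualRep (ρ : A →ₗ[K] V →ₗ[K] V) : A →ₗ[K] Module.Dual K V →ₗ[K] Module.Dual K V :=
  Module.Dual.transpose ∘ₗ ρ

/-- `(ρ, α, β, V)` is a representation of the admissible averaging commutative algebra
`(A, m, P, Q)`. -/
def IsRep (m : A →ₗ[K] A →ₗ[K] A) (P Q : A →ₗ[K] A)
    (ρ : A →ₗ[K] V →ₗ[K] V) (α β : V →ₗ[K] V) : Prop :=
  (∀ x y v, ρ (m x y) v = ρ x (ρ y v)) ∧
  (∀ x v, ρ (P x) (α v) = α (ρ (P x) v) ∧ α (ρ (P x) v) = α (ρ x (α v))) ∧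
  (∀ x v, ρ (P x) (β v) = β (ρ (P x) v) ∧ β (ρ (P x) v) = β (ρ x (β v))) ∧
  (∀ x v, ρ (Q x) (α v) = β (ρ x (α v)) ∧ β (ρ x (α v)) = β (ρ (Q x) v))

/-- `(ρ, α, β, V, mV)` is an `(A, m, P, Q)`-representation algebra. -/
def IsRepAlg (m : A →ₗ[K] A →ₗ[K] A) (P Q : A →ₗ[K] A)
    (ρ : A →ₗ[K] V →ₗ[K] V) (α β : V →ₗ[K] V) (mV : V →ₗ[K] V →ₗ[K] V) : Prop :=
  IsRep m P Q ρ α β ∧ IsAdmissibleAveraging mV α β ∧ ∀ x u v, ρ x (mV u v) = mV (ρ x u) v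

/-- The semidirect-product multiplication on `A × V`:
`(x+u)·(y+v) = x·y + ρ(x)v + ρ(y)u + u ·_V v`. -/
def sdMul (m : A →ₗ[K] A →ₗ[K] A) (ρ : A →ₗ[K] V →ₗ[K] V) (mV : V →ₗ[K] V →ₗ[K] V) :
    (A × V) →ₗ[K] (A × V) →ₗ[K] (A × V) :=
  LinearMap.mk₂ K
    (fun p q => (m p.1 q.1, ρ p.1 q.2 + ρ q.1 p.2 + mV p.2 q.2))
    (fun p p' q => by
      simp only [Prod.fst_add, Prod.snd_add, map_add, LinearMap.add_apply, Prod.mk_add_mk,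
        Prod.mk.injEq]
      exact ⟨trivial, by abel⟩)
    (fun c p q => by
      simp only [Prod.smul_fst, Prod.smul_snd, map_smul, LinearMap.smul_apply, Prod.smul_mk,
        smul_add, Prod.mk.injEq])
    (fun p q q' => by
      simp only [Prod.fst_add, Prod.snd_add, map_add, LinearMap.add_apply, Prod.mk_add_mk,
        Prod.mk.injEq]
      exact ⟨trivial, by abel⟩)
    (fun c p q => by
      simp only [Prod.smul_fst, Prod.smul_snd, map_smul, LinearMap.smul_apply, Prod.smul_mk,
        smul_add, Prod.mk.injEq])

/-- Nondegeneracy of a bilinear form. -/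
def IsNondeg (B : A →ₗ[K] A →ₗ[K] K) : Prop := ∀ x, (∀ y, B x y = 0) → x = 0

/-- `(A, m, B)` is a symmetric Frobenius commutative algebra. -/
def IsSymFrob (m : A →ₗ[K] A →ₗ[K] A) (B : A →ₗ[K] A →ₗ[K] K) : Prop :=
  IsComm m ∧ IsAssoc m ∧ (∀ x y, B x y = B y x) ∧ IsNondeg B ∧
    ∀ x y z, B (m x y) z = B x (m y z)

/-- `R` is a Rota–Baxter operator of weight `l` on `(A, m)`. -/
def IsRB (m : A →ₗ[K] A →ₗ[K] A) (R : A →ₗ[K] A) (l : K) : Prop :=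
  ∀ x y, m (R x) (R y) = R (m (R x) y + m x (R y) + l • m x y)

/-- `(A, m, R, B)` is a symmetric Rota–Baxter Frobenius commutative algebra of weight `l`. -/
def IsSymRBFrob (m : A →ₗ[K] A →ₗ[K] A) (R : A →ₗ[K] A) (B : A →ₗ[K] A →ₗ[K] K) (l : K) :
    Prop :=
  IsSymFrob m B ∧ IsRB m R l ∧ ∀ x y, B (R x) y + B x (R y) + l • B x y = 0

/-- `(A, m, P, R, B)` is a symmetric averaging Rota–Baxter Frobenius commutative algebra of
weight `l`. -/
def IsSymAvgRBFrob (m : A →ₗ[K] A →ₗ[K] A) (P R : A →ₗ[K] A) (B : A →ₗ[K] A →ₗ[K] K)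
    (l : K) : Prop :=
  IsSymRBFrob m R B l ∧ IsAveragingOp m P ∧ P ∘ₗ R = R ∘ₗ P

/-- `(A, tr, lt)` is a special apre-perm algebra (with `x ▷ y = tr x y`, `x ◁ y = lt x y`). -/
def IsSAPP (tr lt : A →ₗ[K] A →ₗ[K] A) : Prop :=
  (∀ x y, lt x y = lt y x) ∧
  (∀ x y z, (tr + lt) x ((tr + lt) y z) = (tr + lt) ((tr + lt) x y) z ∧
      (tr + lt) ((tr + lt) x y) z = (tr + lt) ((tr + lt) y x) z) ∧
  (∀ x y z, lt ((tr + lt) x y) z = (tr + lt) x (lt y z) ∧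
      (tr + lt) x (lt y z) = - lt x (lt y z))

/-- `f(x) = id ⊗ R∘(x) + L◁(x) ⊗ id` on `A ⊗ A`. -/
def fmap (tr lt : A →ₗ[K] A →ₗ[K] A) (x : A) : A ⊗[K] A →ₗ[K] A ⊗[K] A :=
  LinearMap.lTensor A ((tr + lt).flip x) + LinearMap.rTensor A (lt x)

/-- `g(x) = L∘(x) ⊗ id − id ⊗ L∘(x)` on `A ⊗ A`. -/
def gmap (tr lt : A →ₗ[K] A →ₗ[K] A) (x : A) : A ⊗[K] A →ₗ[K] A ⊗[K] A :=
  LinearMap.rTensor A ((tr + lt) x) - LinearMap.lTensor A ((tr + lt) x)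

/-- For `r = Σᵢ uᵢ ⊗ vᵢ`, the element
`SA(r) = Σᵢⱼ (uᵢ∘uⱼ)⊗vᵢ⊗vⱼ + uᵢ⊗(vᵢ◁uⱼ)⊗vⱼ + uᵢ⊗uⱼ⊗(vⱼ∘vᵢ)` of `A⊗A⊗A`. -/
def SAcal (tr lt : A →ₗ[K] A →ₗ[K] A) (r : A ⊗[K] A) : A ⊗[K] (A ⊗[K] A) :=
  place1 (liftM (tr + lt)) (r ⊗ₜ[K] r) + place2 (liftM lt) (r ⊗ₜ[K] r) +
    place3 (flipM (tr + lt)) (r ⊗ₜ[K] r)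

/-- `(A, tr, lt, B)` is a quadratic special apre-perm algebra. -/
def IsQuadSAPP (tr lt : A →ₗ[K] A →ₗ[K] A) (B : A →ₗ[K] A →ₗ[K] K) : Prop :=
  IsSAPP tr lt ∧ (∀ x y, B x y = B y x) ∧ IsNondeg B ∧
    ∀ x y z, B (lt x y) z = - B x ((tr + lt) z y)

/-- `(A, tr, lt, R, B)` is a quadratic Rota–Baxter special apre-perm algebra of weight `l`. -/
def IsQuadRBSAPP (tr lt : A →ₗ[K] A →ₗ[K] A) (R : A →ₗ[K] A) (B : A →ₗ[K] A →ₗ[K] K)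
    (l : K) : Prop :=
  IsQuadSAPP tr lt B ∧ IsRB tr R l ∧ IsRB lt R l ∧
    ∀ x y, B (R x) y + B x (R y) + l • B x y = 0

/-- `x ◁ y = −Q(x·y)` as a bilinear map. -/
def ltOf (m : A →ₗ[K] A →ₗ[K] A) (Q : A →ₗ[K] A) : A →ₗ[K] A →ₗ[K] A :=
  - (LinearMap.llcomp K A A A Q ∘ₗ m)

/-- `x ▷ y = P(x)·y + Q(x·y)` as a bilinear map. -/
def trOf (m : A →ₗ[K] A →ₗ[K] A) (P Q : A →ₗ[K] A) : A →ₗ[K] A →ₗ[K] A :=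
  m ∘ₗ P + LinearMap.llcomp K A A A Q ∘ₗ m

/-- The multiplication `a* ◇_s b* = L*(s♯(a*))(b*)` on `A*`. -/
def diamondMap (m : A →ₗ[K] A →ₗ[K] A) (s : A ⊗[K] A) :
    Module.Dual K A →ₗ[K] Module.Dual K A →ₗ[K] Module.Dual K A :=
  dualRep m ∘ₗ sharp s

/-- The natural bilinear form `B_d(x+a*, y+b*) = ⟨a*, y⟩ + ⟨b*, x⟩` on `A × A*`. -/
def pairForm : (A × Module.Dual K A) →ₗ[K] (A × Module.Dual K A) →ₗ[K] K :=
  LinearMap.mk₂ K (fun p q => p.2 q.1 + q.2 p.1)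
    (fun p p' q => by
      simp only [Prod.fst_add, Prod.snd_add, LinearMap.add_apply, map_add]
      ring)
    (fun c p q => by
      simp only [Prod.smul_fst, Prod.smul_snd, LinearMap.smul_apply, map_smul, smul_eq_mul]
      ring)
    (fun p q q' => by
      simp only [Prod.fst_add, Prod.snd_add, LinearMap.add_apply, map_add]
      ring)
    (fun c p q => by
      simp only [Prod.smul_fst, Prod.smul_snd, LinearMap.smul_apply, map_smul, smul_eq_mul]
      ring)

/-- The Zinbiel and admissibility axioms for `(A, ⋆, P, Q)`. -/
def IsAdmAvgZinbiel (st : A →ₗ[K] A →ₗ[K] A) (P Q : A →ₗ[K] A) : Prop :=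
  (∀ x y z, st x (st y z) = st (st x y) z + st (st y x) z) ∧
  (∀ x y, st (P x) (P y) = P (st (P x) y) ∧ P (st (P x) y) = P (st x (P y))) ∧
  (∀ x y, Q (st (P x) y) = st (P x) (Q y) ∧ st (P x) (Q y) = Q (st x (Q y))) ∧
  (∀ x y, Q (st (Q x) y) = st (Q x) (P y) ∧ st (Q x) (P y) = Q (st x (P y)))

end Defs

end Paper

section Theorems

open Paper

variable {K : Type*} [Field K]
variable {A : Type*} [AddCommGroup A] [Module K A]
variable {V : Type*} [AddCommGroup V] [Module K V]

/-- Pairing of `A ⊗ A` with two functionals. -/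
def pairTwo (f g : Module.Dual K A) : A ⊗[K] A →ₗ[K] K :=
  (TensorProduct.lid K K).toLinearMap ∘ₗ TensorProduct.map f g

/-- Pairing of `A ⊗ A ⊗ A` with three functionals. -/
def pairThree (f g h : Module.Dual K A) : A ⊗[K] (A ⊗[K] A) →ₗ[K] K :=
  (TensorProduct.lid K K).toLinearMap ∘ₗ TensorProduct.map f (pairTwo g h)

lemma pairTwo_tmul (f g : Module.Dual K A) (x y : A) :
    pairTwo f g (x ⊗ₜ[K] y) = f x * g y := by
  simp [pairTwo]

lemma pairThree_tmul (f g h : Module.Dual K A) (x : A) (t : A ⊗[K] A) :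
    pairThree f g h (x ⊗ₜ[K] t) = f x * pairTwo g h t := by
  simp [pairThree]

lemma sharp_tmul (u v : A) (f : Module.Dual K A) : sharp (u ⊗ₜ[K] v) f = f u • v := by
  simp [sharp]

lemma sharp_add (p q : A ⊗[K] A) : sharp (p + q) = sharp p + sharp q := by
  ext f
  simp [sharp]

lemma sharp_zero : sharp (0 : A ⊗[K] A) = 0 := by
  ext f
  simp [sharp]

lemma tau_tmul (u v : A) : tau (u ⊗ₜ[K] v) = v ⊗ₜ[K] u := by
  simp [tau]

lemma tau_add (p q : A ⊗[K] A) : tau (p + q) = tau p + tau q := by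
  simp [tau]

lemma tau_zero : tau (0 : A ⊗[K] A) = 0 := by
  simp [tau]

lemma sharp_tau (p : A ⊗[K] A) (f g : Module.Dual K A) :
    g (sharp (tau p) f) = f (sharp p g) := by
  induction p with
  | zero => simp [sharp_zero, tau_zero]
  | tmul u v => simp [sharp_tmul, tau_tmul, mul_comm]
  | add p q hp hq => simp [sharp_add, tau_add, hp, hq]

lemma pairTwo_rTensor (m : A →ₗ[K] A) (f g : Module.Dual K A) (p : A ⊗[K] A) :
    pairTwo f g (LinearMap.rTensor A m p) = f (m (sharp (tau p) g)) := by
  induction p with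
  | zero => simp [sharp_zero, tau_zero]
  | tmul u v => simp [sharp_tmul, tau_tmul, pairTwo_tmul, mul_comm]
  | add p q hp hq => simp [sharp_add, tau_add, hp, hq]

lemma pairTwo_lTensor (m : A →ₗ[K] A) (f g : Module.Dual K A) (p : A ⊗[K] A) :
    pairTwo f g (LinearMap.lTensor A m p) = g (m (sharp p f)) := by
  induction p with
  | zero => simp [sharp_zero]
  | tmul u v => simp [sharp_tmul, pairTwo_tmul]
  | add p q hp hq => simp [sharp_add, hp, hq]

lemma pairThree_place1 (m : A →ₗ[K] A →ₗ[K] A) (f g h : Module.Dual K A) (p q : A ⊗[K] A) :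
    pairThree f g h (place1 (liftM m) (p ⊗ₜ[K] q)) =
      f (m (sharp (tau p) g) (sharp (tau q) h)) := by
  induction p with
  | zero => simp [sharp_zero, tau_zero]
  | add p p' hp hp' => simp [sharp_add, tau_add, add_tmul, hp, hp']
  | tmul u v =>
    induction q with
    | zero => simp [sharp_zero, tau_zero]
    | add p q hp hq => simp only [sharp_add, tau_add, tmul_add, map_add, LinearMap.add_apply, hp, hq]
    | tmul u' v' =>
      simp [place1, Paper.liftM, sharp_tmul, tau_tmul, pairThree_tmul, pairTwo_tmul]
      ring

lemma pairThree_place2 (m : A →ₗ[K] A →ₗ[K] A) (f g h : Module.Dual K A) (p q : A ⊗[K] A) :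
    pairThree f g h (place2 (liftM m) (p ⊗ₜ[K] q)) =
      g (m (sharp p f) (sharp (tau q) h)) := by
  induction p with
  | zero => simp [sharp_zero]
  | add p p' hp hp' => simp [sharp_add, add_tmul, hp, hp']
  | tmul u v =>
    induction q with
    | zero => simp [sharp_zero, tau_zero]
    | add p q hp hq => simp only [sharp_add, tau_add, tmul_add, map_add, LinearMap.add_apply, hp, hq]
    | tmul u' v' =>
      simp [place2, Paper.liftM, sharp_tmul, tau_tmul, pairThree_tmul, pairTwo_tmul]
      ring

lemma pairThree_place3 (m : A →ₗ[K] A →ₗ[K] A) (f g h : Module.Dual K A) (p q : A ⊗[K] A) :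
    pairThree f g h (place3 (flipM m) (p ⊗ₜ[K] q)) =
      h (m (sharp q g) (sharp p f)) := by
  induction p with
  | zero => simp [sharp_zero]
  | add p p' hp hp' => simp [sharp_add, add_tmul, hp, hp']
  | tmul u v =>
    induction q with
    | zero => simp [sharp_zero]
    | add p q hp hq => simp only [sharp_add, tmul_add, map_add, LinearMap.add_apply, hp, hq]
    | tmul u' v' =>
      simp [place3, flipM, sharp_tmul, pairThree_tmul, pairTwo_tmul]

lemma eq_zero_of_pairTwo [FiniteDimensional K A] (t : A ⊗[K] A)
    (ht : ∀ f g, pairTwo f g t = 0) : t = 0 := by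
  let b := Module.finBasis K A
  apply (b.tensorProduct b).repr.injective
  rw [map_zero]
  ext ⟨i, j⟩
  have key : Finsupp.lapply (i, j) ∘ₗ (b.tensorProduct b).repr.toLinearMap
      = pairTwo (b.coord i) (b.coord j) := by
    ext x y
    simp [pairTwo_tmul, mul_comm]
  have := LinearMap.congr_fun key t
  rw [ht] at this
  simpa using this

lemma eq_zero_of_pairThree [FiniteDimensional K A] (t : A ⊗[K] (A ⊗[K] A))
    (ht : ∀ f g h, pairThree f g h t = 0) : t = 0 := by
  let b := Module.finBasis K A
  apply (b.tensorProduct (b.tensorProduct b)).repr.injective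
  rw [map_zero]
  ext ⟨i, j, k⟩
  have key : Finsupp.lapply (i, j, k) ∘ₗ (b.tensorProduct (b.tensorProduct b)).repr.toLinearMap
      = pairThree (b.coord i) (b.coord j) (b.coord k) := by
    ext x y z
    simp [pairThree_tmul, pairTwo_tmul, mul_comm, mul_left_comm]
  have := LinearMap.congr_fun key t
  rw [ht] at this
  simpa using this

theorem factorizable_from_quad_RB_sapp [FiniteDimensional K A]
    (tr lt : A →ₗ[K] A →ₗ[K] A) (R : A →ₗ[K] A) (B : A →ₗ[K] A →ₗ[K] K)
    (h : IsQuadRBSAPP tr lt R B (-1))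
    (r : A ⊗[K] A) (hr : sharp r ∘ₗ B = R) :
    (∀ x, sharp (r + tau r) (B x) = x) ∧
    (∀ a : Module.Dual K A, B (sharp (r + tau r) a) = a) ∧
    (∀ x : A, fmap tr lt x (r + tau r) = 0) ∧
    (∀ x : A, gmap tr lt x (r + tau r) = 0) ∧
    Function.Bijective (sharp (r + tau r)) ∧
    SAcal tr lt r = 0 := by
  obtain ⟨⟨⟨hcomm, -, -⟩, hsym, hnd, hinv⟩, hRtr, hRlt, hRB⟩ := h
  have hRx : ∀ x, sharp r (B x) = R x := fun x => LinearMap.congr_fun hr x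
  have hBinj : Function.Injective B := by
    rw [injective_iff_map_eq_zero]
    intro x hx
    exact hnd x (fun y => by rw [hx]; rfl)
  have hBsurj : Function.Surjective B :=
    (LinearMap.injective_iff_surjective_of_finrank_eq_finrank
      (Subspace.dual_finrank_eq (K := K) (V := A)).symm).1 hBinj
  have hRB' : ∀ x y, B x (R y) = B x y - B (R x) y := by
    intro x y
    have := hRB x y
    rw [smul_eq_mul] at this
    linear_combination this
  have hSx : ∀ x, sharp (tau r) (B x) = x - R x := by
    intro x
    apply hBinj
    ext y
    rw [hsym, sharp_tau, hRx, hRB', map_sub, LinearMap.sub_apply]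
  have hs : ∀ x, sharp (r + tau r) (B x) = x := by
    intro x
    rw [sharp_add, LinearMap.add_apply, hRx, hSx]
    abel
  have hs' : ∀ a : Module.Dual K A, B (sharp (r + tau r) a) = a := by
    intro a
    obtain ⟨x, rfl⟩ := hBsurj a
    rw [hs]
  have htt : tau (r + tau r) = r + tau r := by
    rw [tau_add, add_comm]
    congr 1
    simp [tau]
  have hself : ∀ x y z, B x ((tr + lt) y z) = B ((tr + lt) y x) z := by
    intro x y z
    have h1 := hinv x z y
    have h2 := hinv z x y
    rw [hcomm z x] at h2
    rw [hsym ((tr + lt) y x) z]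
    linear_combination h1 - h2
  have hRo : ∀ x y, (tr + lt) (R x) (R y) =
      R ((tr + lt) (R x) y) + R ((tr + lt) x (R y)) - R ((tr + lt) x y) := by
    intro x y
    simp only [LinearMap.add_apply, hRtr x y, hRlt x y, map_add, map_neg, neg_smul, one_smul]
    abel
  refine ⟨hs, hs', ?_, ?_, ?_, ?_⟩
  · intro x
    apply eq_zero_of_pairTwo
    intro f g
    obtain ⟨a, rfl⟩ := hBsurj f
    obtain ⟨b, rfl⟩ := hBsurj g
    rw [fmap, LinearMap.add_apply, map_add, pairTwo_lTensor, pairTwo_rTensor, htt, hs, hs,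
      LinearMap.flip_apply, hcomm x b, hsym a, hinv]
    ring
  · intro x
    apply eq_zero_of_pairTwo
    intro f g
    obtain ⟨a, rfl⟩ := hBsurj f
    obtain ⟨b, rfl⟩ := hBsurj g
    rw [gmap, LinearMap.sub_apply, map_sub, pairTwo_lTensor, pairTwo_rTensor, htt, hs, hs,
      hself, hsym b]
    ring
  · refine ⟨fun a b hab => ?_, fun x => ⟨B x, hs x⟩⟩
    rw [← hs' a, hab, hs']
  · apply eq_zero_of_pairThree
    intro f g k
    obtain ⟨a, rfl⟩ := hBsurj f
    obtain ⟨b, rfl⟩ := hBsurj g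
    obtain ⟨c, rfl⟩ := hBsurj k
    rw [SAcal, map_add, map_add, pairThree_place1, pairThree_place2, pairThree_place3]
    simp only [hRx, hSx]
    have hS : ∀ y, B (c - R c) y = B c (R y) := by
      intro y
      rw [hRB', map_sub, LinearMap.sub_apply]
    have e1 : B a ((tr + lt) (b - R b) (c - R c)) = B c (R ((tr + lt) (b - R b) a)) := by
      rw [hself, hsym, hS]
    have e2 : B b (lt (R a) (c - R c)) = - B c (R ((tr + lt) b (R a))) := by
      rw [hsym, hcomm, hinv, hS]
    rw [e1, e2, hRo]
    simp only [map_sub, map_add, LinearMap.sub_apply, LinearMap.add_apply]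
    ring

end Theorems
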